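/- arXiv:1804.09250 — 4 statements merged into one kernel-verified Lean document; each statement's English description precedes it below -/
import Mathlib

section
/- Let X_1,…,X_n be independent real random variables with X_j distributed as the Gaussian N(μ_j, σ_j²) with σ_j > 0, let a ∈ ℝ^n with a ≠ 0, b ∈ ℝ, and β ∈ ℝ. Set g(x) = b + Σ_j a_j x_j, define the directional cosines α_j = a_j σ_j / sqrt(Σ_k a_k² σ_k²) and the shifted point x̄_j = μ_j − α_j σ_j β. Then g(x̄) ≥ 0 if and only if P(g(X) ≤ 0) ≤ Φ(−β). -/
open MeasureTheory ProbabilityTheory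
open scoped NNReal

/-- The cumulative distribution function `Φ` of the standard Gaussian `N(0,1)`. -/
noncomputable def stdNormalCDF : ℝ → ℝ := fun x => (cdf (gaussianReal 0 1)) x

/-- A linear combination of independent Gaussian coordinates is Gaussian. -/
lemma pi_gaussianReal_map_sum_mul {ι : Type*} [Fintype ι] (μ : ι → ℝ) (v : ι → ℝ≥0)
    (a : ι → ℝ) :
    (Measure.pi fun j => gaussianReal (μ j) (v j)).map (fun x => ∑ j, a j * x j) =
      gaussianReal (∑ j, a j * μ j) (∑ j, .mk (a j ^ 2) (sq_nonneg _) * v j) := by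
  have hcomp : (fun x : ι → ℝ => ∑ j, a j * x j) =
      (fun p : ι → ℝ => ∑ j, p j) ∘ fun x j => a j * x j := rfl
  rw [hcomp, ← Measure.map_map (by fun_prop) (by fun_prop),
    Measure.pi_map_pi (f := fun j y => a j * y) (fun j => by fun_prop)]
  simp_rw [gaussianReal_map_const_mul]
  refine Measure.ext_of_charFun (funext fun t => ?_)
  rw [charFun_map_sum_pi_eq_prod, Finset.prod_apply]
  simp_rw [charFun_gaussianReal]
  rw [← Complex.exp_sum]
  push_cast
  rw [Finset.sum_sub_distrib, Finset.mul_sum, Finset.sum_mul, Finset.sum_mul, Finset.sum_div]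

/-- The cdf of a nondegenerate Gaussian is strictly increasing. -/
lemma strictMono_cdf_gaussianReal (m : ℝ) {v : ℝ≥0} (hv : v ≠ 0) :
    StrictMono (cdf (gaussianReal m v)) := by
  intro x y hxy
  have : (gaussianReal m v).IsOpenPosMeasure :=
    (gaussianReal_absolutelyContinuous' m hv).isOpenPosMeasure
  have hpos : 0 < (gaussianReal m v).real (Set.Ioc x y) :=
    ENNReal.toReal_pos
      (((Measure.measure_Ioo_pos _).2 hxy).trans_le (measure_mono Set.Ioo_subset_Ioc_self)).ne'
      (measure_ne_top _ _)
  rw [cdf_eq_real, cdf_eq_real, ← Set.Iic_union_Ioc_eq_Iic hxy.le,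
    measureReal_union (Set.Iic_disjoint_Ioc le_rfl) measurableSet_Ioc]
  linarith

/-- The Gaussian cdf expressed through the standard one. -/
lemma gaussianReal_real_Iic (m x : ℝ) {s : ℝ} (hs : 0 < s) (v : ℝ≥0) (hv : (v : ℝ) = s ^ 2) :
    (gaussianReal m v).real (Set.Iic x) = stdNormalCDF ((x - m) / s) := by
  have hmap : gaussianReal m v = (gaussianReal 0 1).map (fun y => s * y + m) := by
    have hcomp : (fun y => s * y + m) = (fun y => y + m) ∘ fun y => s * y := rfl
    rw [hcomp, ← Measure.map_map (by fun_prop) (by fun_prop), gaussianReal_map_const_mul,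
      gaussianReal_map_add_const]
    congr 1
    · ring
    · ext
      simp [hv]
  rw [stdNormalCDF, cdf_eq_real, hmap, map_measureReal_apply (by fun_prop) measurableSet_Iic]
  congr 1
  ext y
  simp only [Set.mem_preimage, Set.mem_Iic, le_div_iff₀ hs]
  constructor <;> intro h <;> linarith

/-- Correctness of the reliable design space (RDS) transformation for a linear limit
state function under independent Gaussian variables: `g(x̄) ≥ 0` iff
`P(g(X) ≤ 0) ≤ Φ(-β)`, where `x̄` is the mean shifted by `β` standard deviations in the
direction of the most probable point. -/
theorem rds_feasibility_iff_probabilistic_constraint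
    (n : ℕ) (μ σ : Fin n → ℝ) (hσ : ∀ j, 0 < σ j)
    (a : Fin n → ℝ) (ha : a ≠ 0) (b β : ℝ) (α xbar : Fin n → ℝ)
    (hα : ∀ j, α j = a j * σ j / Real.sqrt (∑ k, (a k) ^ 2 * (σ k) ^ 2))
    (hxbar : ∀ j, xbar j = μ j - α j * σ j * β) :
    0 ≤ b + ∑ j, a j * xbar j ↔
      ((Measure.pi fun j => gaussianReal (μ j) ⟨(σ j) ^ 2, sq_nonneg _⟩)
          {x : Fin n → ℝ | b + ∑ j, a j * x j ≤ 0}).toReal ≤ stdNormalCDF (-β) := by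
  set S := ∑ k, (a k) ^ 2 * (σ k) ^ 2 with hS
  have hSpos : 0 < S := by
    obtain ⟨i, hi⟩ := Function.ne_iff.1 ha
    have hi : a i ≠ 0 := hi
    have := hσ i
    exact Finset.sum_pos' (fun k _ => by positivity) ⟨i, Finset.mem_univ i, by positivity⟩
  have hs : 0 < √S := Real.sqrt_pos.2 hSpos
  have hg : b + ∑ j, a j * xbar j = b + ∑ j, a j * μ j - √S * β := by
    have hterm : ∀ j, a j * xbar j = a j * μ j - a j ^ 2 * σ j ^ 2 * (β / √S) := fun j => by
      rw [hxbar, hα]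
      ring
    simp_rw [hterm]
    rw [Finset.sum_sub_distrib, ← Finset.sum_mul, ← hS, ← add_sub_assoc]
    congr 1
    rw [mul_div_left_comm, Real.div_sqrt, mul_comm]
  have hP : ((Measure.pi fun j => gaussianReal (μ j) ⟨(σ j) ^ 2, sq_nonneg _⟩)
      {x : Fin n → ℝ | b + ∑ j, a j * x j ≤ 0}).toReal =
      stdNormalCDF ((-b - ∑ j, a j * μ j) / √S) := by
    rw [← gaussianReal_real_Iic (∑ j, a j * μ j) (-b) hs
        (∑ j, .mk (a j ^ 2) (sq_nonneg _) * .mk (σ j ^ 2) (sq_nonneg _))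
        (by rw [Real.sq_sqrt hSpos.le, hS]; push_cast; rfl),
      ← pi_gaussianReal_map_sum_mul, map_measureReal_apply (by fun_prop) measurableSet_Iic]
    refine congrArg (fun s => Measure.real _ s) (Set.ext fun x => ?_)
    simp only [Set.mem_ofPred_eq, Set.mem_preimage, Set.mem_Iic]
    constructor <;> intro h <;> linarith
  have hmono : StrictMono stdNormalCDF := strictMono_cdf_gaussianReal 0 one_ne_zero
  rw [hP, hg, hmono.le_iff_le, div_le_iff₀ hs]
  constructor <;> intro h <;> linarith
end

section
/- In the setting of the previous statement (independent Gaussians X_j ~ N(μ_j, σ_j²), σ_j > 0, linear limit state g(x) = b + Σ_j a_j x_j with a ≠ 0, directional cosines α_j = a_j σ_j / sqrt(Σ_k a_k² σ_k²), shifted point x̄_j = μ_j − α_j σ_j β): g(x̄) = 0 if and only if P(g(X) ≤ 0) = Φ(−β), i.e., the probabilistic constraint is active exactly when the shifted point lies on the limit state surface. -/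
open MeasureTheory ProbabilityTheory
open scoped NNReal

namespace ProbabilityTheory

/-- A finite sum of independent real Gaussian random variables is Gaussian. -/
theorem iIndepFun.hasLaw_sum_gaussianReal {ι Ω : Type*} {mΩ : MeasurableSpace Ω}
    {P : Measure Ω} {X : ι → Ω → ℝ} {m : ι → ℝ} {v : ι → ℝ≥0} (hX : iIndepFun X P)
    (hlaw : ∀ i, HasLaw (X i) (gaussianReal (m i) (v i)) P) (s : Finset ι) :
    HasLaw (∑ i ∈ s, X i) (gaussianReal (∑ i ∈ s, m i) (∑ i ∈ s, v i)) P := by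
  classical
  have := hX.isProbabilityMeasure
  induction s using Finset.induction_on with
  | empty =>
    refine ⟨by fun_prop, ?_⟩
    simp only [Finset.sum_empty, gaussianReal_zero_var]
    exact (Measure.map_const P (0 : ℝ)).trans (by simp)
  | insert i s hi ih =>
    simp only [Finset.sum_insert hi]
    refine ⟨(hlaw i).aemeasurable.add ih.aemeasurable, ?_⟩
    exact gaussianReal_add_gaussianReal_of_indepFun
      (hX.indepFun_finsetSum_of_notMem₀ (fun j ↦ (hlaw j).aemeasurable) hi).symm
      (hlaw i).map_eq ih.map_eq

/-- The law of a linear combination of independent real Gaussians. -/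
theorem hasLaw_sum_mul_pi_gaussianReal {ι : Type*} [Fintype ι] (m : ι → ℝ) (v : ι → ℝ≥0)
    (a : ι → ℝ) :
    HasLaw (fun x : ι → ℝ ↦ ∑ i, a i * x i)
      (gaussianReal (∑ i, a i * m i) (∑ i, ⟨a i ^ 2, sq_nonneg _⟩ * v i))
      (Measure.pi fun i ↦ gaussianReal (m i) (v i)) := by
  have hlaw (i : ι) : HasLaw (fun x : ι → ℝ ↦ a i * x i)
      (gaussianReal (a i * m i) (⟨a i ^ 2, sq_nonneg _⟩ * v i))
      (Measure.pi fun i ↦ gaussianReal (m i) (v i)) :=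
    gaussianReal_const_mul
      (measurePreserving_eval (fun i ↦ gaussianReal (m i) (v i)) i).hasLaw (a i)
  have hind : iIndepFun (fun (i : ι) (x : ι → ℝ) ↦ a i * x i)
      (Measure.pi fun i ↦ gaussianReal (m i) (v i)) :=
    iIndepFun_pi (X := fun i (y : ℝ) ↦ a i * y) fun i ↦ by fun_prop
  have h := hind.hasLaw_sum_gaussianReal hlaw Finset.univ
  convert! h using 1
  ext x
  simp

theorem cdf_gaussianReal_strictMono (m : ℝ) {v : ℝ≥0} (hv : v ≠ 0) :
    StrictMono (cdf (gaussianReal m v)) := by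
  intro x y hxy
  refine (monotone_cdf _ hxy.le).lt_of_ne fun h ↦ ?_
  have hIoc : gaussianReal m v (Set.Ioc x y) = 0 := by
    rw [← measure_cdf (gaussianReal m v), StieltjesFunction.measure_Ioc, h, sub_self,
      ENNReal.ofReal_zero]
  have hvol := gaussianReal_absolutelyContinuous' m hv hIoc
  rw [Real.volume_Ioc, ENNReal.ofReal_eq_zero] at hvol
  linarith

/-- Standardization of a Gaussian cumulative distribution function. -/
theorem cdf_gaussianReal_eq_cdf_standard (m t : ℝ) {s : ℝ} (hs : 0 < s) {v : ℝ≥0}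
    (hv : (v : ℝ) = s ^ 2) :
    cdf (gaussianReal m v) t = cdf (gaussianReal 0 1) ((t - m) / s) := by
  have hmap : gaussianReal m v = (gaussianReal 0 1).map (fun x ↦ s * x + m) := by
    have h := gaussianReal_add_const (gaussianReal_const_mul
      (HasLaw.id (μ := gaussianReal 0 1)) s) m
    refine Eq.trans ?_ h.map_eq.symm
    congr 1
    · simp
    · ext
      simp [hv]
  rw [cdf_eq_real, cdf_eq_real, hmap, map_measureReal_apply (by fun_prop) measurableSet_Iic]
  congr 1
  ext x
  simp only [Set.mem_preimage, Set.mem_Iic, le_div_iff₀ hs]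
  constructor <;> intro h <;> linarith

end ProbabilityTheory

/-- The "active constraint" case of the reliable design space transformation: for a
linear limit state function under independent Gaussian variables, `g(x̄) = 0` iff
`P(g(X) ≤ 0) = Φ(-β)`. -/
theorem rds_active_constraint_iff
    (n : ℕ) (μ σ : Fin n → ℝ) (hσ : ∀ j, 0 < σ j)
    (a : Fin n → ℝ) (ha : a ≠ 0) (b β : ℝ) (α xbar : Fin n → ℝ)
    (hα : ∀ j, α j = a j * σ j / Real.sqrt (∑ k, (a k) ^ 2 * (σ k) ^ 2))
    (hxbar : ∀ j, xbar j = μ j - α j * σ j * β) :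
    b + ∑ j, a j * xbar j = 0 ↔
      ((Measure.pi fun j => gaussianReal (μ j) ⟨(σ j) ^ 2, sq_nonneg _⟩)
          {x : Fin n → ℝ | b + ∑ j, a j * x j ≤ 0}).toReal = stdNormalCDF (-β) := by
  have hV : 0 < ∑ k, (a k) ^ 2 * (σ k) ^ 2 := by
    obtain ⟨j, hj⟩ := Function.ne_iff.mp ha
    refine Finset.sum_pos' (fun k _ ↦ by positivity) ⟨j, Finset.mem_univ j, ?_⟩
    have := hσ j
    have : a j ≠ 0 := hj
    positivity
  set s := Real.sqrt (∑ k, (a k) ^ 2 * (σ k) ^ 2)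
  have hs : 0 < s := Real.sqrt_pos.mpr hV
  have hs2 : s ^ 2 = ∑ k, (a k) ^ 2 * (σ k) ^ 2 := Real.sq_sqrt hV.le
  have hshift : ∑ j, a j * xbar j = ∑ j, a j * μ j - s * β := by
    have hterm (j : Fin n) : a j * xbar j = a j * μ j - (a j) ^ 2 * (σ j) ^ 2 * (β / s) := by
      rw [hxbar, hα]
      ring
    simp_rw [hterm]
    rw [Finset.sum_sub_distrib, ← Finset.sum_mul, ← hs2]
    field_simp
  have hlaw := hasLaw_sum_mul_pi_gaussianReal μ (fun j ↦ ⟨(σ j) ^ 2, sq_nonneg _⟩) a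
  have hprob : ((Measure.pi fun j => gaussianReal (μ j) ⟨(σ j) ^ 2, sq_nonneg _⟩)
      {x : Fin n → ℝ | b + ∑ j, a j * x j ≤ 0}).toReal =
      stdNormalCDF ((-b - ∑ j, a j * μ j) / s) := by
    rw [stdNormalCDF, ← cdf_gaussianReal_eq_cdf_standard _ _ hs
      (v := ∑ j, ⟨a j ^ 2, sq_nonneg _⟩ * ⟨(σ j) ^ 2, sq_nonneg _⟩)
        (by rw [hs2, NNReal.coe_sum]; rfl),
      cdf_eq_real, ← hlaw.map_eq, map_measureReal_apply (by fun_prop) measurableSet_Iic,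
      measureReal_def]
    congr 2
    ext x
    simp only [Set.mem_ofPred_eq, Set.mem_preimage, Set.mem_Iic]
    constructor <;> intro h <;> linarith
  rw [hprob]
  simp only [stdNormalCDF]
  rw [(cdf_gaussianReal_strictMono 0 one_ne_zero).injective.eq_iff,
    div_eq_iff hs.ne', hshift]
  constructor <;> intro h <;> linarith
end

section
/- Let X_1,…,X_n be independent Gaussians X_j ~ N(μ_j, σ_j²), σ_j > 0, and let g_1,…,g_m be linear limit state functions g_i(x) = b_i + Σ_j a_{ij} x_j with each row a_i ≠ 0, with target reliability indices β_1,…,β_m ∈ ℝ. For each i define α_{ij} = a_{ij} σ_j / sqrt(Σ_k a_{ik}² σ_k²) and x̄^i_j = μ_j − α_{ij} σ_j β_i. Then the mean vector μ satisfies all probabilistic constraints P(g_i(X) ≤ 0) ≤ Φ(−β_i), i = 1,…,m, if and only if it satisfies all deterministic constraints g_i(x̄^i) ≥ 0, i = 1,…,m. Hence the feasible set of the RBDO problem (1) equals the feasible set of the converted deterministic problem (11). -/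
open MeasureTheory ProbabilityTheory
open scoped NNReal

/-- The cumulative distribution function of the standard Gaussian is strictly increasing. -/
lemma strictMono_stdNormalCDF : StrictMono stdNormalCDF := by
  intro x y hxy
  have hpos : gaussianReal 0 1 (Set.Ioc x y) ≠ 0 := by
    intro h
    have hvol := gaussianReal_absolutelyContinuous' 0 one_ne_zero h
    rw [Real.volume_Ioc, ENNReal.ofReal_eq_zero] at hvol
    linarith
  have hdisj : Disjoint (Set.Iic x) (Set.Ioc x y) := Set.Iic_disjoint_Ioc le_rfl
  have hsplit := measureReal_union (μ := gaussianReal 0 1) hdisj measurableSet_Ioc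
  rw [Set.Iic_union_Ioc_eq_Iic hxy.le] at hsplit
  have hreal : 0 < (gaussianReal 0 1).real (Set.Ioc x y) :=
    ENNReal.toReal_pos hpos (measure_ne_top _ _)
  simp only [stdNormalCDF, cdf_eq_real]
  linarith

/-- A finite sum of independent Gaussians is Gaussian; means and variances add up. -/
lemma map_sum_gaussianReal_of_iIndepFun {Ω ι : Type*} [MeasurableSpace Ω] {P : Measure Ω}
    [IsProbabilityMeasure P] {X : ι → Ω → ℝ} {c : ι → ℝ} {v : ι → ℝ≥0}
    (hindep : iIndepFun X P) (hmeas : ∀ i, Measurable (X i))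
    (hX : ∀ i, P.map (X i) = gaussianReal (c i) (v i)) (s : Finset ι) :
    P.map (∑ i ∈ s, X i) = gaussianReal (∑ i ∈ s, c i) (∑ i ∈ s, v i) := by
  classical
  induction s using Finset.induction_on with
  | empty =>
    have h : (0 : Ω → ℝ) = fun _ => 0 := rfl
    simp [h, Measure.map_const]
  | insert i s hi ih =>
    have hind := (hindep.indepFun_finsetSum_of_notMem hmeas hi).symm
    rw [Finset.sum_insert hi, Finset.sum_insert hi, Finset.sum_insert hi]
    exact gaussianReal_add_gaussianReal_of_indepFun hind (hX i) ih

/-- The law of an affine combination of independent Gaussians. -/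
lemma map_affine_pi_gaussianReal {ι : Type*} [Fintype ι] (c : ι → ℝ) (v : ι → ℝ≥0)
    (a : ι → ℝ) (b : ℝ) :
    (Measure.pi fun j => gaussianReal (c j) (v j)).map (fun x => b + ∑ j, a j * x j) =
      gaussianReal (b + ∑ j, a j * c j) (∑ j, NNReal.mk (a j ^ 2) (sq_nonneg _) * v j) := by
  have hindep : iIndepFun (fun j (x : ι → ℝ) => a j * x j)
      (Measure.pi fun j => gaussianReal (c j) (v j)) :=
    iIndepFun_pi (X := fun j (y : ℝ) => a j * y) (fun j => by fun_prop)
  have hlaw : ∀ j, (Measure.pi fun j => gaussianReal (c j) (v j)).map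
      (fun x : ι → ℝ => a j * x j) =
        gaussianReal (a j * c j) (NNReal.mk (a j ^ 2) (sq_nonneg _) * v j) := by
    intro j
    rw [← gaussianReal_map_const_mul (a j),
      ← (measurePreserving_eval (fun j => gaussianReal (c j) (v j)) j).map_eq,
      Measure.map_map (by fun_prop) (by fun_prop)]
    rfl
  have hsum := map_sum_gaussianReal_of_iIndepFun hindep (fun j => by fun_prop) hlaw Finset.univ
  have hcomp : (fun x : ι → ℝ => b + ∑ j, a j * x j) =
      (fun y => b + y) ∘ (∑ j, fun x : ι → ℝ => a j * x j) := by
    ext x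
    simp
  rw [hcomp, ← Measure.map_map (by fun_prop) (by fun_prop), hsum, gaussianReal_map_const_add,
    add_comm]

/-- The lower tail at `0` of a nondegenerate Gaussian in terms of the standard Gaussian. -/
lemma gaussianReal_real_Iic_zero (c : ℝ) {s : ℝ} (hs : 0 < s) {v : ℝ≥0} (hv : (v : ℝ) = s ^ 2) :
    (gaussianReal c v).real (Set.Iic 0) = stdNormalCDF (-c / s) := by
  have hmap : (gaussianReal 0 1).map (fun x => c + s * x) = gaussianReal c v := by
    have hcomp : (fun x => c + s * x) = (fun y => c + y) ∘ (fun x => s * x) := rfl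
    rw [hcomp, ← Measure.map_map (by fun_prop) (by fun_prop), gaussianReal_map_const_mul,
      gaussianReal_map_const_add]
    congr 1
    · simp
    · ext
      simp [hv]
  rw [← hmap, map_measureReal_apply (by fun_prop) measurableSet_Iic]
  simp only [stdNormalCDF, cdf_eq_real]
  congr 1
  ext x
  simp only [Set.mem_preimage, Set.mem_Iic]
  rw [le_div_iff₀ hs]
  constructor <;> intro h <;> linarith

/-- Equivalence of the feasible sets of the RBDO problem (1) and the converted
deterministic problem (11): for independent Gaussians and `m` linear limit state
functions `g i`, the mean vector `μ` satisfies all probabilistic constraints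
`P(gᵢ(X) ≤ 0) ≤ Φ(-βᵢ)` iff it satisfies all deterministic constraints
`gᵢ(x̄ⁱ) ≥ 0` at the per-constraint shifted points `x̄ⁱ`. -/
theorem rds_feasible_set_equivalence
    (n m : ℕ) (μ σ : Fin n → ℝ) (hσ : ∀ j, 0 < σ j)
    (a : Fin m → Fin n → ℝ) (ha : ∀ i, a i ≠ 0) (b : Fin m → ℝ) (β : Fin m → ℝ)
    (α xbar : Fin m → Fin n → ℝ)
    (hα : ∀ i j, α i j = a i j * σ j / Real.sqrt (∑ k, (a i k) ^ 2 * (σ k) ^ 2))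
    (hxbar : ∀ i j, xbar i j = μ j - α i j * σ j * β i) :
    (∀ i, ((Measure.pi fun j => gaussianReal (μ j) ⟨(σ j) ^ 2, sq_nonneg _⟩)
            {x : Fin n → ℝ | b i + ∑ j, a i j * x j ≤ 0}).toReal
          ≤ stdNormalCDF (-β i))
      ↔ (∀ i, 0 ≤ b i + ∑ j, a i j * xbar i j) := by
  refine forall_congr' fun i => ?_
  set S : ℝ := ∑ k, (a i k) ^ 2 * (σ k) ^ 2 with hS
  have hSpos : 0 < S := by
    obtain ⟨j, hj⟩ := Function.ne_iff.mp (ha i)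
    have hj : a i j ≠ 0 := hj
    have := hσ j
    exact Finset.sum_pos' (fun k _ => by positivity) ⟨j, Finset.mem_univ j, by positivity⟩
  have hs : 0 < Real.sqrt S := Real.sqrt_pos.mpr hSpos
  have hsq : Real.sqrt S ^ 2 = S := Real.sq_sqrt hSpos.le
  have hprob : ((Measure.pi fun j => gaussianReal (μ j) ⟨(σ j) ^ 2, sq_nonneg _⟩)
      {x : Fin n → ℝ | b i + ∑ j, a i j * x j ≤ 0}).toReal =
        stdNormalCDF (-(b i + ∑ j, a i j * μ j) / Real.sqrt S) := by
    have hvar : ((∑ j, NNReal.mk (a i j ^ 2) (sq_nonneg _) * NNReal.mk (σ j ^ 2) (sq_nonneg _) :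
        ℝ≥0) : ℝ) = Real.sqrt S ^ 2 := by
      rw [hsq, hS, NNReal.coe_sum]
      rfl
    rw [← gaussianReal_real_Iic_zero _ hs hvar, ← map_affine_pi_gaussianReal,
      map_measureReal_apply (by fun_prop) measurableSet_Iic]
    rfl
  have hpoint : ∑ j, a i j * xbar i j = ∑ j, a i j * μ j - β i * Real.sqrt S := by
    have hterm : ∀ j, a i j * xbar i j =
        a i j * μ j - β i / Real.sqrt S * (a i j ^ 2 * σ j ^ 2) := by
      intro j
      rw [hxbar, hα, ← hS]
      ring
    rw [Finset.sum_congr rfl fun j _ => hterm j, Finset.sum_sub_distrib, ← Finset.mul_sum, ← hS]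
    congr 1
    rw [div_mul_eq_mul_div, div_eq_iff hs.ne', mul_assoc, Real.mul_self_sqrt hSpos.le]
  rw [hprob, strictMono_stdNormalCDF.le_iff_le, div_le_iff₀ hs, hpoint]
  constructor <;> intro h <;> linarith
end

section
/- Fix ε ≥ 0 and let <_ε be the ε-level comparison on pairs (f, ν) ∈ ℝ × ℝ_{≥0} defined by: (f₁, ν₁) <_ε (f₂, ν₂) iff [ν₁ ≤ ε and ν₂ ≤ ε and f₁ < f₂] or [ν₁ = ν₂ and f₁ < f₂] or [¬(ν₁ ≤ ε ∧ ν₂ ≤ ε) and ν₁ ≠ ν₂ and ν₁ < ν₂]. Then <_ε is irreflexive and transitive, i.e., it is a strict order on ℝ × ℝ_{≥0}. -/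
/-- The ε-level comparison `<_ε` of the ε-constraint handling technique (Eq. (31)) is a
strict order on pairs `(f, ν) ∈ ℝ × ℝ≥0`: it is irreflexive and transitive. -/
theorem epsilon_comparison_strict_order
    (ε : ℝ) (hε : 0 ≤ ε)
    (lt : ℝ × ℝ → ℝ × ℝ → Prop)
    (hlt : ∀ p q : ℝ × ℝ, lt p q ↔
      ((p.2 ≤ ε ∧ q.2 ≤ ε ∧ p.1 < q.1) ∨ (p.2 = q.2 ∧ p.1 < q.1) ∨
        (¬(p.2 ≤ ε ∧ q.2 ≤ ε) ∧ p.2 ≠ q.2 ∧ p.2 < q.2))) :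
    (∀ p : ℝ × ℝ, 0 ≤ p.2 → ¬ lt p p) ∧
    (∀ p q r : ℝ × ℝ, 0 ≤ p.2 → 0 ≤ q.2 → 0 ≤ r.2 →
      lt p q → lt q r → lt p r) := by
  refine ⟨fun p _ h => ?_, fun p q r _ _ _ hpq hqr => ?_⟩
  · rw [hlt] at h
    grind
  · rw [hlt] at hpq hqr ⊢
    grind
end
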